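/- For every positive integer n with n ≡ 0 (mod 2), Φ(3×n,3,1) = J*(3×n,3,1); explicitly, Φ(3×n,3,1) = (3n−2)/2 − 1 if n ≡ 2 or 4 (mod 8), and Φ(3×n,3,1) = (3n−2)/2 otherwise. -/

import Mathlib

/-- The cyclic shift of a codeword `B ⊆ I_m × Z_n` by `τ`. -/
def OOCshift {m n : ℕ} (B : Finset (Fin m × ZMod n)) (τ : ZMod n) :
    Finset (Fin m × ZMod n) :=
  B.image fun p => (p.1, p.2 + τ)

/-- A two-dimensional `(m × n, k, lam)` optical orthogonal code: a family of
`k`-element codewords of `I_m × Z_n` with auto- and cross-correlation at most `lam`. -/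
def IsOOC (m n k lam : ℕ) (C : Finset (Finset (Fin m × ZMod n))) : Prop :=
  (∀ A ∈ C, A.card = k) ∧
  (∀ A ∈ C, ∀ τ : ZMod n, τ ≠ 0 → (A ∩ OOCshift A τ).card ≤ lam) ∧
  (∀ A ∈ C, ∀ B ∈ C, A ≠ B → ∀ τ : ZMod n, (A ∩ OOCshift B τ).card ≤ lam)


theorem mem_OOCshift {m n : ℕ} (B : Finset (Fin m × ZMod n)) (τ : ZMod n) (p : Fin m × ZMod n) :
    p ∈ OOCshift B τ ↔ ∃ q ∈ B, q.1 = p.1 ∧ q.2 + τ = p.2 := by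
  unfold OOCshift
  simp only [Finset.mem_image, Prod.ext_iff]

/-- A family of triples, all of whose differences are distinct, is an optical orthogonal code. -/
theorem ooc_of_family {n : ℕ} {ι : Type} [Fintype ι] (w : ι → Fin 3 → Fin 3 × ZMod n)
    (hw : ∀ x y j k j' k', j ≠ k → j' ≠ k' → (w x j).1 = (w y j').1 → (w x k).1 = (w y k').1 →
      (w x k).2 - (w x j).2 = (w y k').2 - (w y j').2 → x = y ∧ j = j' ∧ k = k') :
    ∃ C : Finset (Finset (Fin 3 × ZMod n)), IsOOC 3 n 3 1 C ∧ C.card = Fintype.card ι := by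
  classical
  have hinj : ∀ x, Function.Injective (w x) := by
    intro x j k h
    by_contra hne
    have := hw x x j k k j hne (Ne.symm hne) (by rw [h]) (by rw [h]) (by rw [h])
    exact hne this.2.1
  have hmem : ∀ x p, p ∈ Finset.univ.image (w x) ↔ ∃ j, w x j = p := by
    intro x p; simp
  have key : ∀ x y τ, 1 < ((Finset.univ.image (w x)) ∩ OOCshift (Finset.univ.image (w y)) τ).card →
      x = y ∧ τ = 0 := by
    intro x y τ h
    obtain ⟨p, hp, q, hq, hpq⟩ := Finset.one_lt_card.1 h
    rw [Finset.mem_inter, hmem, mem_OOCshift] at hp hq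
    obtain ⟨⟨j, rfl⟩, p', hp', h1, h2⟩ := hp
    obtain ⟨⟨k, rfl⟩, q', hq', h3, h4⟩ := hq
    obtain ⟨j', rfl⟩ := (hmem _ _).1 hp'
    obtain ⟨k', rfl⟩ := (hmem _ _).1 hq'
    have hjk : j ≠ k := fun e => hpq (by rw [e])
    have hjk' : j' ≠ k' := by
      rintro rfl
      exact hpq (Prod.ext (h1.symm.trans h3) (h2.symm.trans h4))
    obtain ⟨rfl, rfl, rfl⟩ := hw x y j k j' k' hjk hjk' h1.symm h3.symm (by rw [← h2, ← h4]; ring)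
    exact ⟨rfl, by simpa using h2⟩
  have hcinj : Function.Injective (fun x => Finset.univ.image (w x)) := by
    intro x y h
    simp only at h
    refine (key x y 0 ?_).1
    have : OOCshift (Finset.univ.image (w y)) 0 = Finset.univ.image (w y) := by
      unfold OOCshift; simp
    rw [this, ← h, Finset.inter_self, Finset.card_image_of_injective _ (hinj x)]
    simp
  refine ⟨Finset.univ.image (fun x => Finset.univ.image (w x)), ⟨?_, ?_, ?_⟩, ?_⟩
  · intro A hA
    obtain ⟨x, -, rfl⟩ := Finset.mem_image.1 hA
    rw [Finset.card_image_of_injective _ (hinj x)]; simp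
  · intro A hA τ hτ
    obtain ⟨x, -, rfl⟩ := Finset.mem_image.1 hA
    by_contra h
    exact hτ (key x x τ (by omega)).2
  · intro A hA B hB hAB τ
    obtain ⟨x, -, rfl⟩ := Finset.mem_image.1 hA
    obtain ⟨y, -, rfl⟩ := Finset.mem_image.1 hB
    by_contra h
    obtain ⟨rfl, -⟩ := key x y τ (by omega)
    exact hAB rfl
  · rw [Finset.card_image_of_injective _ hcinj]; rfl

/-- A near-starter of `Z_n`: `N` disjoint pairs `{a d, b d}` with differences distinct up to sign,
together with `k` unused elements `l j`. -/
structure NearStarter (n N k : ℕ) (a b : Fin N → ZMod n) (l : Fin k → ZMod n) : Prop where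
  a_inj : ∀ d e, a d = a e → d = e
  b_inj : ∀ d e, b d = b e → d = e
  l_inj : ∀ d e, l d = l e → d = e
  ab : ∀ d e, a d ≠ b e
  al : ∀ d j, a d ≠ l j
  bl : ∀ d j, b d ≠ l j
  p1 : ∀ d e, a d - b d = a e - b e → d = e
  p2 : ∀ d e, a d - b d ≠ b e - a e

/-- The codewords obtained from three near-starters. -/
def wordOf {n N k : ℕ} (a b : Fin 3 → Fin N → ZMod n) (l : Fin 3 → Fin k → ZMod n) :
    (Fin 3 × Fin N) ⊕ Fin k → Fin 3 → Fin 3 × ZMod n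
  | Sum.inl (i, d) => ![(i, - a i d), (i, - b i d), (i + 1, 0)]
  | Sum.inr j => ![(0, 0), (1, l 0 j), (2, l 0 j + l 1 j)]

theorem wordOf_inl_spec {n N k : ℕ} (a b : Fin 3 → Fin N → ZMod n) (l : Fin 3 → Fin k → ZMod n)
    (i : Fin 3) (d : Fin N) (j k' : Fin 3) (hjk : j ≠ k') (r s : Fin 3) (z : ZMod n)
    (hr : (wordOf a b l (Sum.inl (i, d)) j).1 = r) (hs : (wordOf a b l (Sum.inl (i, d)) k').1 = s)
    (hz : (wordOf a b l (Sum.inl (i, d)) k').2 - (wordOf a b l (Sum.inl (i, d)) j).2 = z) :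
    (s = r ∧ r = i ∧ ((z = a i d - b i d ∧ j = 0 ∧ k' = 1) ∨ (z = b i d - a i d ∧ j = 1 ∧ k' = 0))) ∨
    (s = r + 1 ∧ r = i ∧ ((z = a i d ∧ j = 0 ∧ k' = 2) ∨ (z = b i d ∧ j = 1 ∧ k' = 2))) ∨
    (r = s + 1 ∧ s = i ∧ ((z = -a i d ∧ j = 2 ∧ k' = 0) ∨ (z = -b i d ∧ j = 2 ∧ k' = 1))) := by
  subst hr hs hz
  fin_cases j <;> fin_cases k' <;> simp [wordOf] at hjk ⊢ <;> ring

theorem wordOf_inr_spec {n N k : ℕ} (a b : Fin 3 → Fin N → ZMod n) (l : Fin 3 → Fin k → ZMod n)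
    (e : Fin k) (hl : l 0 e + l 1 e + l 2 e = 0) (j k' : Fin 3) (hjk : j ≠ k') (r s : Fin 3)
    (z : ZMod n)
    (hr : (wordOf a b l (Sum.inr e) j).1 = r) (hs : (wordOf a b l (Sum.inr e) k').1 = s)
    (hz : (wordOf a b l (Sum.inr e) k').2 - (wordOf a b l (Sum.inr e) j).2 = z) :
    j = r ∧ k' = s ∧ ((s = r + 1 ∧ z = l r e) ∨ (r = s + 1 ∧ z = - l s e)) := by
  have h2 : l 2 e = -(l 0 e + l 1 e) := by linear_combination hl
  subst hr hs hz
  fin_cases j <;> fin_cases k' <;> simp [wordOf, h2] at hjk ⊢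

theorem ooc_of_nearStarters {n N k : ℕ} (a b : Fin 3 → Fin N → ZMod n)
    (l : Fin 3 → Fin k → ZMod n) (h : ∀ i, NearStarter n N k (a i) (b i) (l i))
    (hl : ∀ e, l 0 e + l 1 e + l 2 e = 0) :
    ∃ C : Finset (Finset (Fin 3 × ZMod n)), IsOOC 3 n 3 1 C ∧ C.card = 3 * N + k := by
  have F1 : ∀ r s : Fin 3, s = r → s = r + 1 → False := by decide
  have F2 : ∀ r s : Fin 3, s = r → r = s + 1 → False := by decide
  have F3 : ∀ r s : Fin 3, s = r + 1 → r = s + 1 → False := by decide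
  have hn : ∀ x y : ZMod n, -x = -y → x = y := fun x y h => neg_injective h
  obtain ⟨C, hC, hc⟩ := ooc_of_family (wordOf a b l) (by
    intro x y j k j' k' hjk hjk' h1 h2 h3
    rcases x with ⟨i, d⟩ | e <;> rcases y with ⟨i', d'⟩ | e'
    · have X := wordOf_inl_spec a b l i d j k hjk _ _ _ h1 h2 h3
      have Y := wordOf_inl_spec a b l i' d' j' k' hjk' _ _ _ rfl rfl rfl
      generalize (wordOf a b l (Sum.inl (i', d')) j').1 = r at *
      generalize (wordOf a b l (Sum.inl (i', d')) k').1 = s at *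
      generalize (wordOf a b l (Sum.inl (i', d')) k').2 - (wordOf a b l (Sum.inl (i', d')) j').2 = z at *
      have hi := h i
      rcases X with ⟨X1, X2, X3⟩ | ⟨X1, X2, X3⟩ | ⟨X1, X2, X3⟩ <;>
      rcases Y with ⟨Y1, Y2, Y3⟩ | ⟨Y1, Y2, Y3⟩ | ⟨Y1, Y2, Y3⟩ <;>
      first
      | exact (F1 _ _ X1 Y1).elim
      | exact (F1 _ _ Y1 X1).elim
      | exact (F2 _ _ X1 Y1).elim
      | exact (F2 _ _ Y1 X1).elim
      | exact (F3 _ _ X1 Y1).elim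
      | exact (F3 _ _ Y1 X1).elim
      | skip
      all_goals
        obtain rfl := X2.symm.trans Y2
        rcases X3 with ⟨X3, rfl, rfl⟩ | ⟨X3, rfl, rfl⟩ <;>
        rcases Y3 with ⟨Y3, rfl, rfl⟩ | ⟨Y3, rfl, rfl⟩ <;>
        have Z := X3.symm.trans Y3
      · simpa using hi.p1 _ _ Z
      · exact (hi.p2 _ _ Z).elim
      · exact (hi.p2 _ _ Z.symm).elim
      · simpa using hi.p1 d d' (by linear_combination -Z)
      · simpa using hi.a_inj _ _ Z
      · exact (hi.ab _ _ Z).elim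
      · exact (hi.ab _ _ Z.symm).elim
      · simpa using hi.b_inj _ _ Z
      · simpa using hi.a_inj _ _ (hn _ _ Z)
      · exact (hi.ab _ _ (hn _ _ Z)).elim
      · exact (hi.ab _ _ (hn _ _ Z).symm).elim
      · simpa using hi.b_inj _ _ (hn _ _ Z)
    · exfalso
      have X := wordOf_inl_spec a b l i d j k hjk _ _ _ h1 h2 h3
      have Y := wordOf_inr_spec a b l e' (hl e') j' k' hjk' _ _ _ rfl rfl rfl
      generalize (wordOf a b l (Sum.inr e') j').1 = r at *
      generalize (wordOf a b l (Sum.inr e') k').1 = s at *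
      generalize (wordOf a b l (Sum.inr e') k').2 - (wordOf a b l (Sum.inr e') j').2 = z at *
      have hi := h i
      obtain ⟨-, -, Y⟩ := Y
      rcases X with ⟨X1, rfl, X3⟩ | ⟨X1, rfl, X3⟩ | ⟨X1, rfl, X3⟩ <;>
      rcases Y with ⟨Y1, Y3⟩ | ⟨Y1, Y3⟩ <;>
      first
      | exact (F1 _ _ X1 Y1).elim
      | exact (F2 _ _ X1 Y1).elim
      | exact (F3 _ _ X1 Y1).elim
      | exact (F3 _ _ Y1 X1).elim
      | skip
      all_goals rcases X3 with ⟨X3, -⟩ | ⟨X3, -⟩ <;> have Z := X3.symm.trans Y3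
      · exact hi.al _ _ Z
      · exact hi.bl _ _ Z
      · exact hi.al _ _ (hn _ _ Z)
      · exact hi.bl _ _ (hn _ _ Z)
    · exfalso
      have X := wordOf_inr_spec a b l e (hl e) j k hjk _ _ _ h1 h2 h3
      have Y := wordOf_inl_spec a b l i' d' j' k' hjk' _ _ _ rfl rfl rfl
      generalize (wordOf a b l (Sum.inl (i', d')) j').1 = r at *
      generalize (wordOf a b l (Sum.inl (i', d')) k').1 = s at *
      generalize (wordOf a b l (Sum.inl (i', d')) k').2 - (wordOf a b l (Sum.inl (i', d')) j').2 = z at *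
      have hi := h i'
      obtain ⟨-, -, X⟩ := X
      rcases Y with ⟨X1, rfl, X3⟩ | ⟨X1, rfl, X3⟩ | ⟨X1, rfl, X3⟩ <;>
      rcases X with ⟨Y1, Y3⟩ | ⟨Y1, Y3⟩ <;>
      first
      | exact (F1 _ _ X1 Y1).elim
      | exact (F2 _ _ X1 Y1).elim
      | exact (F3 _ _ X1 Y1).elim
      | exact (F3 _ _ Y1 X1).elim
      | skip
      all_goals rcases X3 with ⟨X3, -⟩ | ⟨X3, -⟩ <;> have Z := X3.symm.trans Y3
      · exact hi.al _ _ Z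
      · exact hi.bl _ _ Z
      · exact hi.al _ _ (hn _ _ Z)
      · exact hi.bl _ _ (hn _ _ Z)
    · have X := wordOf_inr_spec a b l e (hl e) j k hjk _ _ _ h1 h2 h3
      have Y := wordOf_inr_spec a b l e' (hl e') j' k' hjk' _ _ _ rfl rfl rfl
      generalize (wordOf a b l (Sum.inr e') j').1 = r at *
      generalize (wordOf a b l (Sum.inr e') k').1 = s at *
      generalize (wordOf a b l (Sum.inr e') k').2 - (wordOf a b l (Sum.inr e') j').2 = z at *
      obtain ⟨X1, X2, X⟩ := X
      obtain ⟨Y1, Y2, Y⟩ := Y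
      refine ⟨?_, X1.trans Y1.symm, X2.trans Y2.symm⟩
      rcases X with ⟨X1, X3⟩ | ⟨X1, X3⟩ <;>
      rcases Y with ⟨Y1, Y3⟩ | ⟨Y1, Y3⟩
      · rw [(h r).l_inj _ _ (X3.symm.trans Y3)]
      · exact (F3 _ _ X1 Y1).elim
      · exact (F3 _ _ Y1 X1).elim
      · rw [(h s).l_inj _ _ (hn _ _ (X3.symm.trans Y3))])
  refine ⟨C, hC, ?_⟩
  rw [hc]; simp

/-- Near-starters from pairs of natural numbers, multiplied by a unit. -/
theorem nearStarter_of_nat (t k : ℕ) (c : ℕ) (hc : Nat.Coprime c (2 * t)) (a b : ℕ → ℕ)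
    (l : Fin k → ℕ)
    (hab : ∀ d, 0 < d → d < t → a d = b d + d) (ha : ∀ d, 0 < d → d < t → a d < 2 * t)
    (hl : ∀ j, l j < 2 * t) (linj : ∀ i j, l i = l j → i = j)
    (ainj : ∀ d e, 0 < d → d < t → 0 < e → e < t → a d = a e → d = e)
    (binj : ∀ d e, 0 < d → d < t → 0 < e → e < t → b d = b e → d = e)
    (abne : ∀ d e, 0 < d → d < t → 0 < e → e < t → a d ≠ b e)
    (al : ∀ d j, 0 < d → d < t → a d ≠ l j) (bl : ∀ d j, 0 < d → d < t → b d ≠ l j) :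
    NearStarter (2 * t) (t - 1) k (fun d => (c : ZMod (2 * t)) * (a (d + 1) : ℕ))
      (fun d => (c : ZMod (2 * t)) * (b (d + 1) : ℕ)) (fun j => (c : ZMod (2 * t)) * (l j : ℕ)) := by
  have hu : IsUnit (c : ZMod (2 * t)) := (ZMod.isUnit_iff_coprime c (2 * t)).2 hc
  have canc : ∀ x y : ℕ, x < 2 * t → y < 2 * t →
      (c : ZMod (2 * t)) * (x : ZMod (2 * t)) = (c : ZMod (2 * t)) * (y : ZMod (2 * t)) → x = y := by
    intro x y hx hy h
    have := hu.mul_left_cancel h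
    rw [ZMod.natCast_eq_natCast_iff] at this
    exact Nat.ModEq.eq_of_lt_of_lt this hx hy
  have hd : ∀ d : Fin (t - 1), 0 < (d : ℕ) + 1 ∧ (d : ℕ) + 1 < t := by intro d; omega
  have hb : ∀ d, 0 < d → d < t → b d < 2 * t := by
    intro d h1 h2
    have := hab d h1 h2
    have := ha d h1 h2
    omega
  have hdiff : ∀ d : Fin (t - 1), ((a (d + 1) : ℕ) : ZMod (2 * t)) = (b (d + 1) : ℕ) + ((d + 1 : ℕ) : ZMod (2 * t)) := by
    intro d
    rw [hab _ (hd d).1 (hd d).2]; push_cast; rfl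
  constructor
  · intro d e h
    have := ainj _ _ (hd d).1 (hd d).2 (hd e).1 (hd e).2
      (canc _ _ (ha _ (hd d).1 (hd d).2) (ha _ (hd e).1 (hd e).2) h)
    ext; omega
  · intro d e h
    have := binj _ _ (hd d).1 (hd d).2 (hd e).1 (hd e).2
      (canc _ _ (hb _ (hd d).1 (hd d).2) (hb _ (hd e).1 (hd e).2) h)
    ext; omega
  · intro i j h
    exact linj _ _ (canc _ _ (hl _) (hl _) h)
  · intro d e h
    exact abne _ _ (hd d).1 (hd d).2 (hd e).1 (hd e).2
      (canc _ _ (ha _ (hd d).1 (hd d).2) (hb _ (hd e).1 (hd e).2) h)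
  · intro d j h
    exact al _ _ (hd d).1 (hd d).2 (canc _ _ (ha _ (hd d).1 (hd d).2) (hl _) h)
  · intro d j h
    exact bl _ _ (hd d).1 (hd d).2 (canc _ _ (hb _ (hd d).1 (hd d).2) (hl _) h)
  · intro d e h
    have h1 : ((d + 1 : ℕ) : ZMod (2 * t)) = ((e + 1 : ℕ) : ZMod (2 * t)) := by
      apply hu.mul_left_cancel
      simp only [hdiff] at h
      linear_combination h
    rw [ZMod.natCast_eq_natCast_iff] at h1
    have := Nat.ModEq.eq_of_lt_of_lt h1 (by omega) (by omega)
    ext; omega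
  · intro d e h
    have h1 : ((d + 1 + (e + 1) : ℕ) : ZMod (2 * t)) = ((0 : ℕ) : ZMod (2 * t)) := by
      apply hu.mul_left_cancel
      simp only [hdiff] at h
      push_cast at h ⊢
      linear_combination h
    rw [ZMod.natCast_eq_natCast_iff] at h1
    have hd1 := hd d
    have := Nat.ModEq.eq_of_lt_of_lt h1 (by omega) (by omega)
    omega

/-- Lower elements of the nested near-starter. -/
def nestB (t d : ℕ) : ℕ :=
  if d % 2 = 0 then (t - 1) / 2 + 1 - d / 2
  else 2 * ((t - 1) / 2) + 2 + (t / 2 - 1 - d / 2)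

theorem nest_nearStarter (t c : ℕ) (ht : 0 < t) (hc : Nat.Coprime c (2 * t)) :
    NearStarter (2 * t) (t - 1) 2 (fun d => (c : ZMod (2 * t)) * (nestB t (d + 1) + (d + 1) : ℕ))
      (fun d => (c : ZMod (2 * t)) * (nestB t (d + 1) : ℕ))
      (fun j => (c : ZMod (2 * t)) * ((![0, (t - 1) / 2 + 1] : Fin 2 → ℕ) j : ℕ)) := by
  have hl : ∀ j : Fin 2, (![0, (t - 1) / 2 + 1] : Fin 2 → ℕ) j = 0 ∨
      (![0, (t - 1) / 2 + 1] : Fin 2 → ℕ) j = (t - 1) / 2 + 1 :=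
    Fin.forall_fin_two.2 ⟨Or.inl rfl, Or.inr rfl⟩
  refine nearStarter_of_nat t 2 c hc (fun d => nestB t d + d) (nestB t) ![0, (t - 1) / 2 + 1]
    ?_ ?_ ?_ ?_ ?_ ?_ ?_ ?_ ?_
  · intros; rfl
  · intro d h1 h2
    simp only [nestB]; split_ifs <;> omega
  · exact Fin.forall_fin_two.2 ⟨by change 0 < 2 * t; omega, by change (t - 1) / 2 + 1 < 2 * t; omega⟩
  · intro i j; fin_cases i <;> fin_cases j <;> simp
  · intro d e h1 h2 h3 h4
    simp only [nestB]; split_ifs <;> omega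
  · intro d e h1 h2 h3 h4
    simp only [nestB]; split_ifs <;> omega
  · intro d e h1 h2 h3 h4
    simp only [nestB]; split_ifs <;> omega
  · intro d j h1 h2
    have := hl j
    simp only [nestB]; split_ifs <;> omega
  · intro d j h1 h2
    have := hl j
    simp only [nestB]; split_ifs <;> omega

/-- Lower elements of the Skolem sequence of order `4 s`, without the largest difference. -/
def skolB (s d : ℕ) : ℕ :=
  if d % 2 = 0 then 6 * s - d / 2
  else if d = 1 then s
  else if d = 4 * s - 1 then 2 * s + 1
  else if d = 2 * s - 1 then 2 * s
  else if d = 2 * s + 1 then s - 1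
  else if 2 * s + 1 < d then 2 * s - 1 - d / 2
  else 2 * s - d / 2

theorem skolB_spec (s d : ℕ) (h0 : 0 < d) (h1 : d < 4 * s) :
    (d % 2 = 0 ∧ skolB s d + d / 2 = 6 * s) ∨
    (d = 1 ∧ skolB s d = s) ∨
    (d = 4 * s - 1 ∧ skolB s d = 2 * s + 1) ∨
    (d = 2 * s - 1 ∧ 1 < d ∧ d < 4 * s - 1 ∧ skolB s d = 2 * s) ∨
    (d = 2 * s + 1 ∧ 1 < d ∧ d < 4 * s - 1 ∧ skolB s d + 1 = s) ∨
    (d % 2 = 1 ∧ 2 * s + 1 < d ∧ d < 4 * s - 1 ∧ skolB s d + 1 + d / 2 = 2 * s) ∨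
    (d % 2 = 1 ∧ d < 2 * s - 1 ∧ 1 < d ∧ skolB s d + d / 2 = 2 * s) := by
  unfold skolB
  by_cases c0 : d % 2 = 0
  · rw [if_pos c0]; exact Or.inl ⟨c0, by omega⟩
  rw [if_neg c0]; right
  by_cases c1 : d = 1
  · rw [if_pos c1]; exact Or.inl ⟨c1, rfl⟩
  rw [if_neg c1]; right
  by_cases c2 : d = 4 * s - 1
  · rw [if_pos c2]; exact Or.inl ⟨c2, rfl⟩
  rw [if_neg c2]; right
  by_cases c3 : d = 2 * s - 1
  · rw [if_pos c3]; exact Or.inl ⟨c3, by omega, by omega, rfl⟩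
  rw [if_neg c3]; right
  by_cases c4 : d = 2 * s + 1
  · rw [if_pos c4]; exact Or.inl ⟨c4, by omega, by omega, by omega⟩
  rw [if_neg c4]; right
  by_cases c5 : 2 * s + 1 < d
  · rw [if_pos c5]; exact Or.inl ⟨by omega, by omega, by omega, by omega⟩
  · rw [if_neg c5]; exact Or.inr ⟨by omega, by omega, by omega, by omega⟩

theorem skol_nearStarter (s c : ℕ) (hs : 0 < s) (hc : Nat.Coprime c (2 * (4 * s))) :
    NearStarter (2 * (4 * s)) (4 * s - 1) 2
      (fun d => (c : ZMod (2 * (4 * s))) * (skolB s (d + 1) + (d + 1) : ℕ))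
      (fun d => (c : ZMod (2 * (4 * s))) * (skolB s (d + 1) : ℕ))
      (fun j => (c : ZMod (2 * (4 * s))) * ((![0, 4 * s] : Fin 2 → ℕ) j : ℕ)) := by
  have hl : ∀ j : Fin 2, (![0, 4 * s] : Fin 2 → ℕ) j = 0 ∨ (![0, 4 * s] : Fin 2 → ℕ) j = 4 * s :=
    Fin.forall_fin_two.2 ⟨Or.inl rfl, Or.inr rfl⟩
  refine nearStarter_of_nat (4 * s) 2 c hc (fun d => skolB s d + d) (skolB s) ![0, 4 * s]
    ?_ ?_ ?_ ?_ ?_ ?_ ?_ ?_ ?_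
  · intros; rfl
  · intro d h1 h2
    have := skolB_spec s d h1 h2
    change skolB s d + d < _
    omega
  · intro j
    have := hl j
    omega
  · intro i j; fin_cases i <;> fin_cases j <;> simp <;> omega
  · intro d e h1 h2 h3 h4 h
    change skolB s d + d = skolB s e + e at h
    rcases skolB_spec s d h1 h2 with H | H | H | H | H | H | H <;>
    rcases skolB_spec s e h3 h4 with K | K | K | K | K | K | K <;> omega
  · intro d e h1 h2 h3 h4 h
    rcases skolB_spec s d h1 h2 with H | H | H | H | H | H | H <;>
    rcases skolB_spec s e h3 h4 with K | K | K | K | K | K | K <;> omega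
  · intro d e h1 h2 h3 h4 h
    change skolB s d + d = skolB s e at h
    rcases skolB_spec s d h1 h2 with H | H | H | H | H | H | H <;>
    rcases skolB_spec s e h3 h4 with K | K | K | K | K | K | K <;> omega
  · intro d j h1 h2 h
    change skolB s d + d = _ at h
    have := hl j
    rcases skolB_spec s d h1 h2 with H | H | H | H | H | H | H <;> omega
  · intro d j h1 h2 h
    have := hl j
    rcases skolB_spec s d h1 h2 with H | H | H | H | H | H | H <;> omega

theorem NearStarter.single {n N : ℕ} {a b : Fin N → ZMod n} {l : Fin 2 → ZMod n}
    (h : NearStarter n N 2 a b l) : NearStarter n N 1 a b (fun _ => l 0) :=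
  ⟨h.a_inj, h.b_inj, fun _ _ _ => Subsingleton.elim _ _, h.ab, fun d _ => h.al d 0,
    fun d _ => h.bl d 0, h.p1, h.p2⟩

theorem lower_deficient (t : ℕ) (ht : 0 < t) :
    ∃ C : Finset (Finset (Fin 3 × ZMod (2 * t))), IsOOC 3 (2 * t) 3 1 C ∧
      C.card = 3 * (t - 1) + 1 := by
  have h := (nest_nearStarter t 1 ht (by simp)).single
  exact ooc_of_nearStarters (fun _ => _) (fun _ => _) (fun _ => _) (fun _ => h) (by simp)

theorem lower_three (t : ℕ) (ht : t % 4 = 3) :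
    ∃ C : Finset (Finset (Fin 3 × ZMod (2 * t))), IsOOC 3 (2 * t) 3 1 C ∧
      C.card = 3 * (t - 1) + 2 := by
  obtain ⟨q, rfl⟩ : ∃ q, t = 4 * q + 3 := ⟨t / 4, by omega⟩
  have hcop : Nat.Coprime (2 * q + 1) (2 * (4 * q + 3)) := by
    apply Nat.Coprime.mul_right
    · simp
    · have : 4 * q + 3 = 1 + (2 * q + 1) * 2 := by ring
      rw [this]; simp
  let c : Fin 3 → ℕ := ![1, 2 * q + 1, 2 * q + 1]
  have hc : ∀ i, Nat.Coprime (c i) (2 * (4 * q + 3)) := by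
    intro i; fin_cases i
    · simp [c]
    · exact hcop
    · exact hcop
  refine ooc_of_nearStarters _ _ _ (fun i => nest_nearStarter (4 * q + 3) (c i) (by omega) (hc i)) ?_
  intro e
  fin_cases e
  · simp
  · have h1 : (4 * q + 3 - 1) / 2 + 1 = 2 * (q + 1) := by omega
    have h2 : ((2 * (4 * q + 3) : ℕ) : ZMod (2 * (4 * q + 3))) = 0 := ZMod.natCast_self _
    simp only [c, h1]
    simp
    push_cast at h2
    linear_combination ((q : ZMod (2 * (4 * q + 3))) + 1) * h2

theorem lower_zero (t : ℕ) (ht0 : 0 < t) (ht : t % 4 = 0) :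
    ∃ C : Finset (Finset (Fin 3 × ZMod (2 * t))), IsOOC 3 (2 * t) 3 1 C ∧
      C.card = 3 * (t - 1) + 2 := by
  obtain ⟨s, rfl⟩ : ∃ s, t = 4 * s := ⟨t / 4, by omega⟩
  have hS := nest_nearStarter (4 * s) 1 ht0 (by simp)
  have hR := skol_nearStarter s 1 (by omega) (by simp)
  let a := fun d : Fin (4 * s - 1) => ((1 : ℕ) : ZMod (2 * (4 * s))) * (nestB (4 * s) (d + 1) + (d + 1) : ℕ)
  let b := fun d : Fin (4 * s - 1) => ((1 : ℕ) : ZMod (2 * (4 * s))) * (nestB (4 * s) (d + 1) : ℕ)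
  let l := fun j : Fin 2 =>
    ((1 : ℕ) : ZMod (2 * (4 * s))) * ((![0, (4 * s - 1) / 2 + 1] : Fin 2 → ℕ) j : ℕ)
  refine ooc_of_nearStarters
    ![a, a, fun d => ((1 : ℕ) : ZMod (2 * (4 * s))) * (skolB s (d + 1) + (d + 1) : ℕ)]
    ![b, b, fun d => ((1 : ℕ) : ZMod (2 * (4 * s))) * (skolB s (d + 1) : ℕ)]
    ![l, l, fun j => ((1 : ℕ) : ZMod (2 * (4 * s))) * ((![0, 4 * s] : Fin 2 → ℕ) j : ℕ)] ?_ ?_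
  · intro i; fin_cases i
    · exact hS
    · exact hS
    · exact hR
  · intro e
    fin_cases e
    · simp [l]
    · have h1 : (4 * s - 1) / 2 + 1 = 2 * s := by omega
      have h2 : ((2 * (4 * s) : ℕ) : ZMod (2 * (4 * s))) = 0 := ZMod.natCast_self _
      simp [l, h1]
      push_cast at h2
      linear_combination h2

theorem upper_key {n : ℕ} (C : Finset (Finset (Fin 3 × ZMod n))) (hC : IsOOC 3 n 3 1 C)
    (A B : Finset (Fin 3 × ZMod n)) (hA : A ∈ C) (hB : B ∈ C) (p q p' q' : Fin 3 × ZMod n)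
    (hp : p ∈ A) (hq : q ∈ A) (hpq : p ≠ q) (hp' : p' ∈ B) (hq' : q' ∈ B)
    (h1 : p.1 = p'.1) (h2 : q.1 = q'.1) (h3 : q.2 - p.2 = q'.2 - p'.2) :
    A = B ∧ p = p' ∧ q = q' := by
  have hmp : p ∈ A ∩ OOCshift B (p.2 - p'.2) := by
    rw [Finset.mem_inter, mem_OOCshift]
    exact ⟨hp, p', hp', h1.symm, by ring⟩
  have hmq : q ∈ A ∩ OOCshift B (p.2 - p'.2) := by
    rw [Finset.mem_inter, mem_OOCshift]
    exact ⟨hq, q', hq', h2.symm, by linear_combination -h3⟩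
  have hcard : 1 < (A ∩ OOCshift B (p.2 - p'.2)).card :=
    Finset.one_lt_card.2 ⟨p, hmp, q, hmq, hpq⟩
  have hAB : A = B := by
    by_contra hne
    have := hC.2.2 A hA B hB hne (p.2 - p'.2)
    omega
  subst hAB
  have h0 : p.2 - p'.2 = 0 := by
    by_contra hne
    have := hC.2.1 A hA _ hne
    omega
  exact ⟨rfl, Prod.ext h1 (by linear_combination h0), Prod.ext h2 (by linear_combination h3 + h0)⟩

/-- Parity of a residue modulo `2 t`. -/
def par (t : ℕ) : ZMod (2 * t) →+* ZMod 2 := ZMod.castHom (Dvd.intro t rfl) (ZMod 2)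

theorem card_par (t : ℕ) [NeZero (2 * t)] :
    (Finset.univ.filter (fun x : ZMod (2 * t) => par t x = 1)).card = t := by
  have h1 : (Finset.univ.filter (fun x : ZMod (2 * t) => par t x = 1)).card =
      (Finset.univ.filter (fun x : ZMod (2 * t) => ¬ par t x = 1)).card := by
    apply Finset.card_bij (fun x _ => x + 1)
    · intro x hx
      simp only [Finset.mem_filter, Finset.mem_univ, true_and] at hx ⊢
      rw [map_add, hx, map_one]; decide
    · intro x _ y _ h; exact add_right_cancel h
    · intro y hy
      simp only [Finset.mem_filter, Finset.mem_univ, true_and] at hy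
      refine ⟨y - 1, ?_, by ring⟩
      simp only [Finset.mem_filter, Finset.mem_univ, true_and]
      rw [map_sub, map_one]
      generalize par t y = z at *
      revert z; decide
  have h2 := Finset.card_filter_add_card_filter_not (s := (Finset.univ : Finset (ZMod (2 * t))))
    (fun x => par t x = 1)
  rw [Finset.card_univ, ZMod.card] at h2
  omega

theorem word_parity {t : ℕ} (A : Finset (Fin 3 × ZMod (2 * t))) (hA : A.card = 3) :
    4 ∣ (A.offDiag.filter (fun x => par t (x.2.2 - x.1.2) = 1)).card := by
  classical
  set O := A.filter (fun p => par t p.2 = 1) with hO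
  set E := A.filter (fun p => ¬ par t p.2 = 1) with hE
  have hOE : O.card + E.card = 3 := by
    exact (Finset.card_filter_add_card_filter_not _).trans hA
  have h : A.offDiag.filter (fun x => par t (x.2.2 - x.1.2) = 1) = O ×ˢ E ∪ E ×ˢ O := by
    have hz : ∀ u v : ZMod 2, v - u = 1 ↔ (u = 1 ∧ ¬ v = 1) ∨ (¬ u = 1 ∧ v = 1) := by decide
    ext ⟨p, q⟩
    simp only [hO, hE, Finset.mem_filter, Finset.mem_offDiag, Finset.mem_union, Finset.mem_product,
      map_sub, hz]
    constructor
    · rintro ⟨⟨h1, h2, h3⟩, h4 | h4⟩ <;> tauto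
    · rintro (⟨⟨h1, h2⟩, h3, h4⟩ | ⟨⟨h1, h2⟩, h3, h4⟩)
      · refine ⟨⟨h1, h3, ?_⟩, by tauto⟩
        rintro rfl; exact h4 h2
      · refine ⟨⟨h1, h3, ?_⟩, by tauto⟩
        rintro rfl; exact h2 h4
  have hdis : Disjoint (O ×ˢ E) (E ×ˢ O) := by
    rw [Finset.disjoint_left]
    rintro ⟨p, q⟩ h1 h2
    simp only [hO, hE, Finset.mem_filter, Finset.mem_product] at h1 h2
    exact h2.1.2 h1.1.2
  rw [h, Finset.card_union_of_disjoint hdis, Finset.card_product, Finset.card_product]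
  have hc : O.card ≤ 3 := by omega
  have he : E.card = 3 - O.card := by omega
  rw [he]
  generalize O.card = o at hc
  interval_cases o <;> decide

/-- The unattainable differences. -/
def badSet (t : ℕ) : Finset (Fin 3 × Fin 3 × ZMod (2 * t)) :=
  Finset.univ.image (fun i : Fin 3 => (i, i, (0 : ZMod (2 * t)))) ∪
    Finset.univ.image (fun i : Fin 3 => (i, i, (t : ZMod (2 * t))))

theorem upper_bound (t : ℕ) (ht : 0 < t) (C : Finset (Finset (Fin 3 × ZMod (2 * t))))
    (hC : IsOOC 3 (2 * t) 3 1 C) :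
    C.card ≤ 3 * t - 1 ∧ (t % 4 = 1 ∨ t % 4 = 2 → C.card ≠ 3 * t - 1) := by
  classical
  have : NeZero (2 * t) := ⟨by omega⟩
  have htt : (t : ZMod (2 * t)) + t = 0 := by
    have h2 : ((2 * t : ℕ) : ZMod (2 * t)) = 0 := ZMod.natCast_self _
    push_cast at h2
    linear_combination h2
  have ht0 : (t : ZMod (2 * t)) ≠ 0 := by
    intro h
    rw [ZMod.natCast_eq_zero_iff] at h
    have := Nat.le_of_dvd ht h
    omega
  let P : Finset (Σ _ : Finset (Fin 3 × ZMod (2 * t)),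
      (Fin 3 × ZMod (2 * t)) × (Fin 3 × ZMod (2 * t))) := C.sigma (fun A => A.offDiag)
  let D : (Σ _ : Finset (Fin 3 × ZMod (2 * t)),
      (Fin 3 × ZMod (2 * t)) × (Fin 3 × ZMod (2 * t))) → Fin 3 × Fin 3 × ZMod (2 * t) :=
    fun x => (x.2.1.1, x.2.2.1, x.2.2.2 - x.2.1.2)
  have hDinj : Set.InjOn D P := by
    rintro ⟨A, p, q⟩ hx ⟨B, p', q'⟩ hy h
    simp only [P, Finset.coe_sigma, Set.mem_sigma_iff, Finset.mem_coe, Finset.mem_offDiag] at hx hy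
    simp only [D, Prod.mk.injEq] at h
    obtain ⟨rfl, rfl, rfl⟩ := upper_key C hC A B hx.1 hy.1 p q p' q' hx.2.1 hx.2.2.1 hx.2.2.2
      hy.2.1 hy.2.2.1 h.1 h.2.1 h.2.2
    rfl
  have hPcard : P.card = 6 * C.card := by
    simp only [P, Finset.card_sigma]
    rw [Finset.sum_congr rfl (g := fun _ => 6), Finset.sum_const, smul_eq_mul, mul_comm]
    intro A hA
    rw [Finset.offDiag_card, hC.1 A hA]
  have hbaddis : Disjoint (Finset.univ.image (fun i : Fin 3 => (i, i, (0 : ZMod (2 * t)))))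
      (Finset.univ.image (fun i : Fin 3 => (i, i, (t : ZMod (2 * t))))) := by
    rw [Finset.disjoint_left]
    intro x h1 h2
    obtain ⟨i, -, rfl⟩ := Finset.mem_image.1 h1
    obtain ⟨j, -, h⟩ := Finset.mem_image.1 h2
    simp only [Prod.mk.injEq] at h
    exact ht0 h.2.2
  have hcz : ∀ z : ZMod (2 * t), (Finset.univ.image (fun i : Fin 3 => (i, i, z))).card = 3 := by
    intro z
    rw [Finset.card_image_of_injective]
    · simp
    · intro i j h; simpa using h
  have hbad : (badSet t).card = 6 := by
    rw [badSet, Finset.card_union_of_disjoint hbaddis, hcz, hcz]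
  have hsub : P.image D ⊆ (badSet t)ᶜ := by
    intro y hy
    obtain ⟨⟨A, p, q⟩, hx, rfl⟩ := Finset.mem_image.1 hy
    simp only [P, Finset.mem_sigma, Finset.mem_offDiag] at hx
    obtain ⟨hA, hp, hq, hpq⟩ := hx
    rw [Finset.mem_compl]
    intro hb
    simp only [badSet, D, Finset.mem_union, Finset.mem_image, Finset.mem_univ, true_and,
      Prod.mk.injEq] at hb
    rcases hb with ⟨i, h1, h2, h3⟩ | ⟨i, h1, h2, h3⟩
    · exact hpq (Prod.ext (h1.symm.trans h2) (by linear_combination h3))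
    · exact hpq (upper_key C hC A A hA hA p q q p hp hq hpq hq hp (h1.symm.trans h2)
        (h2.symm.trans h1) (by linear_combination htt - 2 * h3)).2.1
  have hcompl : ((badSet t)ᶜ).card = 18 * t - 6 := by
    rw [Finset.card_compl, hbad]
    simp only [Fintype.card_prod, Fintype.card_fin, ZMod.card]
    omega
  have hle : 6 * C.card ≤ 18 * t - 6 := by
    rw [← hPcard, ← Finset.card_image_of_injOn hDinj, ← hcompl]
    exact Finset.card_le_card hsub
  refine ⟨by omega, ?_⟩
  intro ht4 hcard
  have heq : P.image D = (badSet t)ᶜ := by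
    apply Finset.eq_of_subset_of_card_le hsub
    rw [hcompl, Finset.card_image_of_injOn hDinj, hPcard]
    omega
  -- the number of odd differences is divisible by four
  have hodd4 : 4 ∣ (P.filter (fun x => par t (x.2.2.2 - x.2.1.2) = 1)).card := by
    have : P.filter (fun x => par t (x.2.2.2 - x.2.1.2) = 1) =
        C.sigma (fun A => A.offDiag.filter (fun x => par t (x.2.2 - x.1.2) = 1)) := by
      ext ⟨A, x⟩
      simp only [P, Finset.mem_filter, Finset.mem_sigma, and_assoc]
    rw [this, Finset.card_sigma]
    exact Finset.dvd_sum (fun A hA => word_parity A (hC.1 A hA))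
  have himg : (P.filter (fun x => par t (x.2.2.2 - x.2.1.2) = 1)).image D =
      ((badSet t)ᶜ).filter (fun y => par t y.2.2 = 1) := by
    rw [← heq, Finset.filter_image]
  have hcardeq : (P.filter (fun x => par t (x.2.2.2 - x.2.1.2) = 1)).card =
      (((badSet t)ᶜ).filter (fun y => par t y.2.2 = 1)).card := by
    rw [← himg, Finset.card_image_of_injOn]
    exact hDinj.mono (by exact_mod_cast Finset.filter_subset _ _)
  rw [hcardeq] at hodd4
  have hall : ((Finset.univ : Finset (Fin 3 × Fin 3 × ZMod (2 * t))).filter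
      (fun y => par t y.2.2 = 1)).card = 9 * t := by
    have : (Finset.univ : Finset (Fin 3 × Fin 3 × ZMod (2 * t))).filter
      (fun y => par t y.2.2 = 1) = (Finset.univ : Finset (Fin 3)) ×ˢ
        ((Finset.univ : Finset (Fin 3)) ×ˢ Finset.univ.filter (fun x => par t x = 1)) := by
      ext ⟨i, j, x⟩; simp
    rw [this, Finset.card_product, Finset.card_product, card_par]
    simp only [Finset.card_univ, Fintype.card_fin]
    omega
  have hsplit : (((badSet t)ᶜ).filter (fun y => par t y.2.2 = 1)).card +
      ((badSet t).filter (fun y => par t y.2.2 = 1)).card = 9 * t := by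
    rw [← hall, ← Finset.card_union_of_disjoint]
    · congr 1
      rw [← Finset.filter_union, Finset.union_comm, Finset.union_compl]
    · exact Finset.disjoint_filter_filter disjoint_compl_left
  have hbadodd : ((badSet t).filter (fun y => par t y.2.2 = 1)).card =
      if t % 2 = 1 then 3 else 0 := by
    have hpt : par t (t : ZMod (2 * t)) = ((t % 2 : ℕ) : ZMod 2) := by
      rw [map_natCast]; simp
    rw [badSet, Finset.filter_union, Finset.filter_image, Finset.filter_image]
    simp only [map_zero, hpt]
    rcases Nat.mod_two_eq_zero_or_one t with h | h
    · simp [h]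
    · simp [h, hcz]
  rw [hbadodd] at hsplit
  split_ifs at hsplit <;> omega

theorem stmt_19 (n : ℕ) (hn : 0 < n) (hn2 : n % 2 = 0) (Phi : ℕ)
    (hPhi : Phi = if n % 8 = 2 ∨ n % 8 = 4
        then (3 * n - 2) / 2 - 1 else (3 * n - 2) / 2) :
    (∃ C : Finset (Finset (Fin 3 × ZMod n)), IsOOC 3 n 3 1 C ∧ C.card = Phi) ∧
    (∀ C : Finset (Finset (Fin 3 × ZMod n)), IsOOC 3 n 3 1 C → C.card ≤ Phi) := by
  obtain ⟨t, rfl⟩ : ∃ t, n = 2 * t := ⟨n / 2, by omega⟩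
  have ht : 0 < t := by omega
  split_ifs at hPhi with h
  · constructor
    · obtain ⟨C, hC, hc⟩ := lower_deficient t ht
      exact ⟨C, hC, by omega⟩
    · intro C hC
      obtain ⟨h1, h2⟩ := upper_bound t ht C hC
      have := h2 (by omega)
      omega
  · constructor
    · have h4 : t % 4 = 0 ∨ t % 4 = 3 := by omega
      rcases h4 with h4 | h4
      · obtain ⟨C, hC, hc⟩ := lower_zero t ht h4
        exact ⟨C, hC, by omega⟩
      · obtain ⟨C, hC, hc⟩ := lower_three t h4
        exact ⟨C, hC, by omega⟩
    · intro C hC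
      obtain ⟨h1, -⟩ := upper_bound t ht C hC
      omega
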